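/- arXiv:2511.17924 — 4 statements merged into one kernel-verified Lean document; each statement's English description precedes it below -/
import Mathlib

section
/- Let A and B be n×n complex matrices (n ≥ 1) such that A is Hermitian positive definite with trace 1 and B is Hermitian positive semidefinite with trace 1, and let η > 0 be a real number. If 2·λmax(B) ≤ η·λmin(A), then the 2n×2n block matrix M_a = fromBlocks ((1/2)A) ((1/η)B) ((1/η)B) ((1/2)A) is positive semidefinite and has trace 1. -/
open scoped ComplexOrder

/-- The smallest eigenvalue of a Hermitian matrix. -/
noncomputable def lamMin {n : ℕ} {A : Matrix (Fin n) (Fin n) ℂ} (hA : A.IsHermitian) : ℝ :=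
  ⨅ i, hA.eigenvalues i

/-- The largest eigenvalue of a Hermitian matrix. -/
noncomputable def lamMax {n : ℕ} {A : Matrix (Fin n) (Fin n) ℂ} (hA : A.IsHermitian) : ℝ :=
  ⨆ i, hA.eigenvalues i

namespace Matrix

/-- The Hermitian matrix `a • A + c • 1` is positive semidefinite when `a * μ + c` is nonnegative
for every eigenvalue `μ` of `A`. -/
lemma IsHermitian.posSemidef_smul_add_smul_one {m : Type*} [Fintype m] [DecidableEq m]
    {A : Matrix m m ℂ} (hA : A.IsHermitian) {a c : ℝ} (h : ∀ i, 0 ≤ a * hA.eigenvalues i + c) :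
    (a • A + c • (1 : Matrix m m ℂ)).PosSemidef := by
  have hD : (diagonal fun i => ((a * hA.eigenvalues i + c : ℝ) : ℂ)).PosSemidef :=
    PosSemidef.diagonal fun i => Complex.zero_le_real.2 (h i)
  have hconj := hD.mul_mul_conjTranspose_same (hA.eigenvectorUnitary : Matrix m m ℂ)
  have hU : (hA.eigenvectorUnitary : Matrix m m ℂ) *
      (hA.eigenvectorUnitary : Matrix m m ℂ)ᴴ = 1 :=
    Unitary.coe_mul_star_self hA.eigenvectorUnitary
  have hdiag : (diagonal fun i => ((a * hA.eigenvalues i + c : ℝ) : ℂ)) =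
      a • diagonal (RCLike.ofReal ∘ hA.eigenvalues) + c • (1 : Matrix m m ℂ) := by
    ext i j
    by_cases hij : i = j <;> simp [hij]
  rw [hdiag, Matrix.mul_add, Matrix.add_mul, Matrix.mul_smul, Matrix.smul_mul, Matrix.mul_smul,
    Matrix.smul_mul, Matrix.mul_one, hU] at hconj
  convert hconj using 3
  conv_lhs => rw [hA.spectral_theorem, Unitary.conjStarAlgAut_apply]
  rfl

/-- The block matrix `[[X, Y], [Y, X]]` is positive semidefinite when `X + Y` and `X - Y` are. -/
lemma PosSemidef.fromBlocks_of_add_of_sub {m : Type*} [Fintype m] [DecidableEq m]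
    {X Y : Matrix m m ℂ} (hadd : (X + Y).PosSemidef) (hsub : (X - Y).PosSemidef) :
    (fromBlocks X Y Y X).PosSemidef := by
  have hhalf : (0 : ℝ) ≤ 1 / 2 := by norm_num
  have h := ((hadd.smul hhalf).mul_mul_conjTranspose_same
      (fromRows (1 : Matrix m m ℂ) (1 : Matrix m m ℂ))).add
    ((hsub.smul hhalf).mul_mul_conjTranspose_same
      (fromRows (1 : Matrix m m ℂ) (-1 : Matrix m m ℂ)))
  convert h using 1
  simp only [conjTranspose_fromRows_eq_fromCols_conjTranspose, fromRows_mul, mul_fromCols,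
    fromCols_fromRows_eq_fromBlocks, conjTranspose_neg, conjTranspose_one, fromBlocks_add,
    Matrix.one_mul, Matrix.mul_one, Matrix.neg_mul, Matrix.mul_neg, fromRows_neg, neg_neg]
  congr 1 <;> module

end Matrix

/-- If `A` is Hermitian positive definite with trace 1, `B` is Hermitian positive
semidefinite with trace 1, `η > 0` and `2·λmax(B) ≤ η·λmin(A)`, then the block matrix
`[[A/2, B/η],[B/η, A/2]]` is positive semidefinite with trace 1. -/
theorem anamorphic_block_density_matrix_of_eigenvalue_bound
    {n : ℕ} (hn : 1 ≤ n) (A B : Matrix (Fin n) (Fin n) ℂ) (η : ℝ) (hη : 0 < η)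
    (hA : A.PosDef) (hAtr : A.trace = 1)
    (hB : B.PosSemidef) (hBtr : B.trace = 1)
    (hcond : 2 * lamMax hB.1 ≤ η * lamMin hA.1) :
    (Matrix.fromBlocks ((1 / 2 : ℝ) • A) ((1 / η : ℝ) • B)
        ((1 / η : ℝ) • B) ((1 / 2 : ℝ) • A)).PosSemidef ∧
    (Matrix.fromBlocks ((1 / 2 : ℝ) • A) ((1 / η : ℝ) • B)
        ((1 / η : ℝ) • B) ((1 / 2 : ℝ) • A)).trace = 1 := by
  have hlow : ∀ i, lamMin hA.1 ≤ hA.1.eigenvalues i :=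
    fun i => ciInf_le (Set.finite_range _).bddBelow i
  have hhigh : ∀ i, hB.1.eigenvalues i ≤ lamMax hB.1 :=
    fun i => le_ciSup (Set.finite_range _).bddAbove i
  have hhalf : (0 : ℝ) ≤ 1 / 2 := by norm_num
  have hinv : (0 : ℝ) ≤ 1 / η := by positivity
  refine ⟨Matrix.PosSemidef.fromBlocks_of_add_of_sub
    ((hA.posSemidef.smul hhalf).add (hB.smul hinv)) ?_, ?_⟩
  · have hgap : 0 ≤ 1 / 2 * lamMin hA.1 - 1 / η * lamMax hB.1 := by
      have : 1 / 2 * lamMin hA.1 - 1 / η * lamMax hB.1 =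
          (η * lamMin hA.1 - 2 * lamMax hB.1) / (2 * η) := by field_simp
      rw [this]
      exact div_nonneg (sub_nonneg.2 hcond) (by positivity)
    have hApos := hA.1.posSemidef_smul_add_smul_one (a := 1 / 2) (c := -(1 / 2 * lamMin hA.1))
      fun i => by linarith [hlow i]
    have hBpos := hB.1.posSemidef_smul_add_smul_one (a := -(1 / η)) (c := 1 / η * lamMax hB.1)
      fun i => by linarith [mul_le_mul_of_nonneg_left (hhigh i) hinv]
    have h := (hApos.add hBpos).add
      ((Matrix.PosSemidef.one (n := Fin n) (R := ℂ)).smul hgap)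
    convert h using 1
    module
  · simp only [Matrix.trace, Fintype.sum_sum_type, Matrix.diag_apply, Matrix.fromBlocks_apply₁₁,
      Matrix.fromBlocks_apply₂₂, Matrix.smul_apply, ← Finset.smul_sum] at hAtr ⊢
    rw [hAtr, ← add_smul]
    norm_num
end

section
/- Let n ≥ 2 and let Φ be any n×n complex matrix. For a permutation σ of Fin n let P_σ denote its permutation matrix, with entries (P_σ)_{i j} = 1 if σ(j) = i and 0 otherwise. Let T(Φ) = Tr(Φ) and S(Φ) = Σ_{i,j} Φ_{i j} (the sum of all entries), let I be the n×n identity, and let J be the n×n all-ones matrix. Then (1/n!) · Σ_{σ ∈ Sym(Fin n)} P_σ * Φ * P_σᵀ = ((n·T(Φ) − S(Φ))/(n(n−1))) • I + ((S(Φ) − T(Φ))/(n(n−1))) • J. -/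
open scoped Matrix

/-- The permutation matrix of `σ`, with entries `(P_σ)_{i j} = 1` if `σ j = i` and `0`
otherwise. -/
def permMat (n : ℕ) (σ : Equiv.Perm (Fin n)) : Matrix (Fin n) (Fin n) ℂ :=
  Matrix.of fun i j => if σ j = i then 1 else 0

theorem exists_perm_apply_eq_of_ne {α : Type*} [DecidableEq α] {i j k l : α}
    (hij : i ≠ j) (hkl : k ≠ l) :
    ∃ τ : Equiv.Perm α, τ i = k ∧ τ j = l := by
  refine ⟨Equiv.swap (Equiv.swap i k j) l * Equiv.swap i k, ?_, by simp⟩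
  rw [Equiv.Perm.mul_apply, Equiv.swap_apply_left]
  refine Equiv.swap_apply_of_ne_of_ne (fun h => hij ?_) hkl
  exact (Equiv.swap i k).injective (by rw [Equiv.swap_apply_left, ← h])

section PermSums

variable {α M : Type*} [Fintype α] [DecidableEq α] [AddCommMonoid M]

open Finset

/-- Sums over all permutations of a function of the images of two points are invariant under
permuting these points. -/
theorem sum_perm_apply_perm (f : α → α → M) (τ : Equiv.Perm α) (i j : α) :
    ∑ σ : Equiv.Perm α, f (σ (τ i)) (σ (τ j)) = ∑ σ : Equiv.Perm α, f (σ i) (σ j) :=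
  Fintype.sum_equiv (Equiv.mulRight τ) _ _ fun _ => rfl

theorem sum_sum_sum_perm (f : α → α → M) :
    ∑ i, ∑ j, ∑ σ : Equiv.Perm α, f (σ i) (σ j) =
      (Fintype.card α).factorial • ∑ i, ∑ j, f i j := by
  have h (σ : Equiv.Perm α) : ∑ i, ∑ j, f (σ i) (σ j) = ∑ i, ∑ j, f i j := by
    rw [← Equiv.sum_comp σ fun i => ∑ j, f i j]
    exact sum_congr rfl fun i _ => Equiv.sum_comp σ (f (σ i))
  rw [sum_congr rfl fun i _ => sum_comm, sum_comm, sum_congr rfl fun σ _ => h σ, sum_const,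
    card_univ, Fintype.card_perm]

theorem card_nsmul_sum_perm_apply (g : α → M) (i : α) :
    Fintype.card α • ∑ σ : Equiv.Perm α, g (σ i) =
      (Fintype.card α).factorial • ∑ x, g x := by
  have h (k : α) : ∑ σ : Equiv.Perm α, g (σ k) = ∑ σ : Equiv.Perm α, g (σ i) := by
    simpa using sum_perm_apply_perm (fun x _ => g x) (Equiv.swap i k) i i
  rw [← card_univ (α := α), ← sum_const, ← sum_congr rfl fun k _ => h k, sum_comm,
    sum_congr rfl fun σ _ => Equiv.sum_comp σ g, sum_const, card_univ, card_univ,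
    Fintype.card_perm]

theorem card_mul_nsmul_sum_perm_apply_apply (f : α → α → M) {i j : α} (hij : i ≠ j) :
    (Fintype.card α * (Fintype.card α - 1)) • ∑ σ : Equiv.Perm α, f (σ i) (σ j) +
        (Fintype.card α).factorial • ∑ x, f x x =
      (Fintype.card α).factorial • ∑ x, ∑ y, f x y := by
  have hoff (k l : α) (hkl : l ≠ k) :
      ∑ σ : Equiv.Perm α, f (σ k) (σ l) = ∑ σ : Equiv.Perm α, f (σ i) (σ j) := by
    obtain ⟨τ, rfl, rfl⟩ := exists_perm_apply_eq_of_ne hij hkl.symm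
    exact sum_perm_apply_perm f τ i j
  have hrow (k : α) : ∑ l, ∑ σ : Equiv.Perm α, f (σ k) (σ l) =
      (Fintype.card α - 1) • ∑ σ : Equiv.Perm α, f (σ i) (σ j) +
        ∑ σ : Equiv.Perm α, f (σ k) (σ k) := by
    rw [← sum_erase_add _ _ (mem_univ k),
      sum_congr rfl fun l hl => hoff k l (ne_of_mem_erase hl), sum_const,
      card_erase_of_mem (mem_univ k), card_univ]
  have hdiag : ∑ k, ∑ σ : Equiv.Perm α, f (σ k) (σ k) =
      (Fintype.card α).factorial • ∑ x, f x x := by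
    rw [sum_comm, sum_congr rfl fun σ _ => Equiv.sum_comp σ fun x => f x x, sum_const,
      card_univ, Fintype.card_perm]
  rw [← sum_sum_sum_perm, sum_congr rfl fun k _ => hrow k, sum_add_distrib, sum_const,
    card_univ, hdiag, mul_nsmul']

end PermSums

theorem permMat_mul_mul_transpose_apply (n : ℕ) (σ : Equiv.Perm (Fin n))
    (Φ : Matrix (Fin n) (Fin n) ℂ) (i j : Fin n) :
    (permMat n σ * Φ * (permMat n σ)ᵀ) i j = Φ (σ⁻¹ i) (σ⁻¹ j) := by
  have h (k l : Fin n) : σ k = l ↔ k = σ⁻¹ l := Equiv.Perm.eq_inv_iff_eq.symm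
  simp [permMat, Matrix.mul_apply, h]

theorem sum_permMat_mul_mul_transpose_apply (n : ℕ) (Φ : Matrix (Fin n) (Fin n) ℂ)
    (i j : Fin n) :
    (∑ σ : Equiv.Perm (Fin n), permMat n σ * Φ * (permMat n σ)ᵀ) i j =
      ∑ σ : Equiv.Perm (Fin n), Φ (σ i) (σ j) := by
  simp_rw [Matrix.sum_apply, permMat_mul_mul_transpose_apply]
  exact Equiv.sum_comp (Equiv.inv (Equiv.Perm (Fin n))) fun σ => Φ (σ i) (σ j)

/-- Twirling a matrix `Φ` over the symmetric group (averaging `P_σ Φ P_σᵀ` over all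
permutations `σ`) yields `α • I + β • J` with `α = (n·Tr(Φ) − S(Φ))/(n(n−1))` and
`β = (S(Φ) − Tr(Φ))/(n(n−1))`, where `S(Φ)` is the sum of all entries of `Φ` and `J` is
the all-ones matrix. -/
theorem perm_twirl_eq
    (n : ℕ) (hn : 2 ≤ n) (Φ : Matrix (Fin n) (Fin n) ℂ) :
    ((n.factorial : ℂ))⁻¹ • ∑ σ : Equiv.Perm (Fin n), permMat n σ * Φ * (permMat n σ)ᵀ
      = ((((n : ℂ) * Φ.trace - ∑ i, ∑ j, Φ i j) / ((n : ℂ) * ((n : ℂ) - 1))) •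
          (1 : Matrix (Fin n) (Fin n) ℂ))
        + ((((∑ i, ∑ j, Φ i j) - Φ.trace) / ((n : ℂ) * ((n : ℂ) - 1))) •
          Matrix.of (fun _ _ => (1 : ℂ))) := by
  have hn0 : (n : ℂ) ≠ 0 := by exact_mod_cast (by omega : n ≠ 0)
  have hn1 : (n : ℂ) - 1 ≠ 0 := sub_ne_zero.mpr (by exact_mod_cast (by omega : n ≠ 1))
  have hfac : (n.factorial : ℂ) ≠ 0 := by exact_mod_cast n.factorial_ne_zero
  ext i j
  rw [Matrix.smul_apply, sum_permMat_mul_mul_transpose_apply]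
  simp only [Matrix.add_apply, Matrix.smul_apply, Matrix.of_apply, smul_eq_mul, mul_one]
  rcases eq_or_ne i j with rfl | hij
  · have h := card_nsmul_sum_perm_apply (fun x => Φ x x) i
    simp only [Fintype.card_fin, nsmul_eq_mul] at h
    change _ = _ * Φ.trace at h
    rw [Matrix.one_apply_eq, mul_one, ← add_div, inv_mul_eq_div,
      div_eq_div_iff hfac (mul_ne_zero hn0 hn1)]
    linear_combination ((n : ℂ) - 1) * h
  · have h := card_mul_nsmul_sum_perm_apply_apply Φ hij
    simp only [Fintype.card_fin, nsmul_eq_mul, Nat.cast_mul,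
      Nat.cast_sub (by omega : 1 ≤ n), Nat.cast_one] at h
    change _ + _ * Φ.trace = _ at h
    rw [Matrix.one_apply_ne hij, mul_zero, zero_add, inv_mul_eq_div,
      div_eq_div_iff hfac (mul_ne_zero hn0 hn1)]
    linear_combination h
end

section
/- For n ≥ 1 and a key k : Fin n → Fin 2 × Fin 2, let U_k be the n-qubit Pauli matrix ⊗_i X^{aᵢ} Z^{bᵢ} (where k i = (aᵢ, bᵢ)), namely the matrix indexed by (Fin n → Fin 2) with entries (U_k)_{x y} = ∏_{i} ((if x i = y i + aᵢ then 1 else 0) · (−1)^{bᵢ · (y i)}), where addition in Fin 2 is mod 2. Then for every complex matrix ρ indexed by (Fin n → Fin 2): (1/4^n) · Σ_{k : Fin n → Fin 2 × Fin 2} U_k * ρ * U_kᴴ = (Tr ρ / 2^n) • I. In particular, averaging the quantum one-time pad over a uniformly random key sends every density matrix to the maximally mixed state I/2^n. -/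
open scoped Matrix

/-- The `n`-qubit Pauli operator `⊗ᵢ X^{aᵢ} Z^{bᵢ}` determined by a key
`k : Fin n → Fin 2 × Fin 2` (with `k i = (aᵢ, bᵢ)`), as a matrix indexed by
`Fin n → Fin 2`, with entries
`∏ᵢ (if xᵢ = yᵢ + aᵢ then 1 else 0) · (−1)^(bᵢ·yᵢ)` (arithmetic in `Fin 2`). -/
def pauliOfKey (n : ℕ) (k : Fin n → Fin 2 × Fin 2) :
    Matrix (Fin n → Fin 2) (Fin n → Fin 2) ℂ :=
  Matrix.of fun x y =>
    ∏ i : Fin n,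
      ((if x i = y i + (k i).1 then (1 : ℂ) else 0) *
        (-1 : ℂ) ^ (((k i).2 : ℕ) * ((y i : ℕ))))

/-- The single-qubit Pauli matrices are orthogonal: summing the product of an entry of
`X^a Z^b` with the conjugate of another entry over all `(a, b)`. -/
theorem sum_pauli_entry_mul_star (x y u v : Fin 2) :
    ∑ p : Fin 2 × Fin 2,
        ((if x = u + p.1 then (1 : ℂ) else 0) * (-1 : ℂ) ^ ((p.2 : ℕ) * (u : ℕ))) *
          star ((if y = v + p.1 then (1 : ℂ) else 0) * (-1 : ℂ) ^ ((p.2 : ℕ) * (v : ℕ)))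
      = 2 * ((if x = y then 1 else 0) * (if u = v then 1 else 0)) := by
  fin_cases x <;> fin_cases y <;> fin_cases u <;> fin_cases v <;>
    norm_num [Fintype.sum_prod_type, Fin.sum_univ_two, show (1 + 1 : Fin 2) = 0 from rfl]

/-- The `n`-qubit Pauli operators are orthogonal, entrywise. -/
theorem sum_pauliOfKey_mul_star (n : ℕ) (x y u v : Fin n → Fin 2) :
    ∑ k : Fin n → Fin 2 × Fin 2, pauliOfKey n k x u * star (pauliOfKey n k y v)
      = 2 ^ n * ((if x = y then 1 else 0) * (if u = v then 1 else 0)) := by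
  simp only [pauliOfKey, Matrix.of_apply, star_prod, ← Finset.prod_mul_distrib]
  rw [← Fintype.prod_sum fun i (p : Fin 2 × Fin 2) =>
    ((if x i = u i + p.1 then (1 : ℂ) else 0) * (-1 : ℂ) ^ ((p.2 : ℕ) * (u i : ℕ))) *
      star ((if y i = v i + p.1 then (1 : ℂ) else 0) * (-1 : ℂ) ^ ((p.2 : ℕ) * (v i : ℕ)))]
  simp only [sum_pauli_entry_mul_star, Finset.prod_mul_distrib, Finset.prod_const,
    Finset.card_univ, Fintype.card_fin, Fintype.prod_boole, funext_iff]
  congr!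

/-- The unnormalised Pauli twirl. -/
theorem sum_pauliOfKey_conj (n : ℕ) (ρ : Matrix (Fin n → Fin 2) (Fin n → Fin 2) ℂ) :
    ∑ k : Fin n → Fin 2 × Fin 2, pauliOfKey n k * ρ * (pauliOfKey n k)ᴴ
      = (2 ^ n * ρ.trace) • (1 : Matrix (Fin n → Fin 2) (Fin n → Fin 2) ℂ) := by
  ext x y
  calc (∑ k : Fin n → Fin 2 × Fin 2, pauliOfKey n k * ρ * (pauliOfKey n k)ᴴ) x y
      = ∑ v, ∑ u, ρ u v *
          ∑ k : Fin n → Fin 2 × Fin 2, pauliOfKey n k x u * star (pauliOfKey n k y v) := by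
        simp only [Matrix.sum_apply, Matrix.mul_apply, Matrix.conjTranspose_apply,
          Finset.sum_mul, Finset.mul_sum]
        rw [Finset.sum_comm]
        refine Finset.sum_congr rfl fun v _ => ?_
        rw [Finset.sum_comm]
        exact Finset.sum_congr rfl fun u _ => Finset.sum_congr rfl fun k _ => by ring
    _ = _ := by
        simp only [sum_pauliOfKey_mul_star]
        by_cases h : x = y <;>
          simp [h, Matrix.trace, ← Finset.sum_mul, mul_comm]

/-- Pauli twirl / quantum one-time pad: averaging `U_k ρ U_kᴴ` over a uniformly random
key `k` sends every matrix `ρ` to `(Tr ρ / 2^n) • I`. -/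
theorem pauli_twirl
    (n : ℕ) (hn : 1 ≤ n) (ρ : Matrix (Fin n → Fin 2) (Fin n → Fin 2) ℂ) :
    ((1 : ℂ) / 4 ^ n) • ∑ k : Fin n → Fin 2 × Fin 2,
        pauliOfKey n k * ρ * (pauliOfKey n k)ᴴ
      = (ρ.trace / 2 ^ n) • (1 : Matrix (Fin n → Fin 2) (Fin n → Fin 2) ℂ) := by
  rw [sum_pauliOfKey_conj, smul_smul]
  congr 1
  have h : (4 : ℂ) ^ n = 2 ^ n * 2 ^ n := by
    rw [← mul_pow]
    norm_num
  rw [h]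
  field_simp
end

section
/- Let m ≥ 1, let λ, μ : Fin m → ℝ with λᵢ > 0 and μᵢ ≥ 0 for all i, and let η > 0 be a real number such that 2·μᵢ ≤ η·λᵢ for every i. Then Σ_i (λᵢ/2) · ((1 + xᵢ)·logb 2 (1 + xᵢ) + (1 − xᵢ)·logb 2 (1 − xᵢ)) ≤ (4/η²) · Σ_i μᵢ²/λᵢ, where xᵢ = 2μᵢ/(η·λᵢ). In particular, the quantum relative entropy between the anamorphic and original ciphertexts in the simultaneously diagonalizable case is at most (4/η²)·Σ_i μᵢ²/λᵢ. -/
theorem hasSum_one_add_mul_log_add_one_sub_mul_log {x : ℝ} (hx : |x| < 1) :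
    HasSum (fun n : ℕ => (2 / (2 * n + 1) - 1 / (n + 1)) * (x ^ 2) ^ (n + 1))
      ((1 + x) * Real.log (1 + x) + (1 - x) * Real.log (1 - x)) := by
  obtain ⟨hl, hr⟩ := abs_lt.mp hx
  have hsq : |x ^ 2| < 1 := by
    rw [abs_pow]
    exact pow_lt_one₀ (abs_nonneg x) hx two_ne_zero
  have hsub := ((Real.hasSum_log_sub_log_of_abs_lt_one hx).mul_left x).sub
    (Real.hasSum_pow_div_log_of_abs_lt_one hsq)
  have hlog : Real.log (1 - x ^ 2) = Real.log (1 + x) + Real.log (1 - x) := by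
    rw [← Real.log_mul (by linarith) (by linarith)]
    ring_nf
  have hvalue : x * (Real.log (1 + x) - Real.log (1 - x)) - -Real.log (1 - x ^ 2) =
      (1 + x) * Real.log (1 + x) + (1 - x) * Real.log (1 - x) := by
    rw [hlog]
    ring
  have hterm (n : ℕ) : x * (2 * (1 / (2 * n + 1)) * x ^ (2 * n + 1)) -
      (x ^ 2) ^ (n + 1) / (n + 1) = (2 / (2 * n + 1) - 1 / (n + 1)) * (x ^ 2) ^ (n + 1) := by
    rw [← pow_mul]
    ring
  simp only [hterm, hvalue] at hsub
  exact hsub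

theorem one_add_mul_log_add_one_sub_mul_log_mul_sq_le {x y : ℝ}
    (hx : 0 ≤ x) (hxy : x ≤ y) (hy : y < 1) :
    ((1 + x) * Real.log (1 + x) + (1 - x) * Real.log (1 - x)) * y ^ 2 ≤
      ((1 + y) * Real.log (1 + y) + (1 - y) * Real.log (1 - y)) * x ^ 2 := by
  have hx1 : |x| < 1 := by rw [abs_of_nonneg hx]; linarith
  have hy1 : |y| < 1 := by rw [abs_of_nonneg (hx.trans hxy)]; exact hy
  refine hasSum_le (fun n => ?_)
    ((hasSum_one_add_mul_log_add_one_sub_mul_log hx1).mul_right (y ^ 2))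
    ((hasSum_one_add_mul_log_add_one_sub_mul_log hy1).mul_right (x ^ 2))
  have hcoef : (0 : ℝ) ≤ 2 / (2 * n + 1) - 1 / (n + 1) := by
    rw [sub_nonneg, div_le_div_iff₀ (by positivity) (by positivity)]
    linarith
  have hpow : (x ^ 2) ^ n ≤ (y ^ 2) ^ n := by gcongr
  have hnonneg : 0 ≤ (2 / (2 * n + 1) - 1 / (n + 1)) * (x ^ 2 * y ^ 2) := by positivity
  calc (2 / (2 * n + 1) - 1 / (n + 1)) * (x ^ 2) ^ (n + 1) * y ^ 2
      = (2 / (2 * n + 1) - 1 / (n + 1)) * (x ^ 2 * y ^ 2) * (x ^ 2) ^ n := by ring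
    _ ≤ (2 / (2 * n + 1) - 1 / (n + 1)) * (x ^ 2 * y ^ 2) * (y ^ 2) ^ n := by gcongr
    _ = (2 / (2 * n + 1) - 1 / (n + 1)) * (y ^ 2) ^ (n + 1) * x ^ 2 := by ring

theorem one_add_mul_log_add_one_sub_mul_log_le {x : ℝ} (hx : 0 ≤ x) (hx1 : x ≤ 1) :
    (1 + x) * Real.log (1 + x) + (1 - x) * Real.log (1 - x) ≤ 2 * Real.log 2 * x ^ 2 := by
  rcases hx1.eq_or_lt with rfl | hlt
  · norm_num
  have hadd : Continuous fun y : ℝ => (1 + y) * Real.log (1 + y) :=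
    Real.continuous_mul_log.comp (continuous_const.add continuous_id)
  have hsub : Continuous fun y : ℝ => (1 - y) * Real.log (1 - y) :=
    Real.continuous_mul_log.comp (continuous_const.sub continuous_id)
  have hleft : Continuous fun y : ℝ =>
      ((1 + x) * Real.log (1 + x) + (1 - x) * Real.log (1 - x)) * y ^ 2 := by fun_prop
  have hright : Continuous fun y : ℝ =>
      ((1 + y) * Real.log (1 + y) + (1 - y) * Real.log (1 - y)) * x ^ 2 :=
    (hadd.add hsub).mul continuous_const
  have hlim := le_of_tendsto_of_tendsto (b := nhdsWithin 1 (Set.Iio 1))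
    (hleft.tendsto 1 |>.mono_left nhdsWithin_le_nhds)
    (hright.tendsto 1 |>.mono_left nhdsWithin_le_nhds) (by
      filter_upwards [Ioo_mem_nhdsLT hlt] with y hy
      exact one_add_mul_log_add_one_sub_mul_log_mul_sq_le hx hy.1.le hy.2)
  norm_num at hlim
  exact hlim

theorem one_add_mul_logb_two_add_one_sub_mul_logb_two_le {x : ℝ} (hx : 0 ≤ x) (hx1 : x ≤ 1) :
    (1 + x) * Real.logb 2 (1 + x) + (1 - x) * Real.logb 2 (1 - x) ≤ 2 * x ^ 2 := by
  have hlog : 0 < Real.log 2 := Real.log_pos one_lt_two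
  have hle := one_add_mul_log_add_one_sub_mul_log_le hx hx1
  rw [← Real.log_div_log, ← Real.log_div_log, mul_div_assoc', mul_div_assoc', ← add_div,
    div_le_iff₀ hlog]
  linarith

/-- Bound on the relative-entropy sum in the simultaneously diagonalizable case: with
`xᵢ = 2μᵢ/(η·λᵢ) ∈ [0,1]`,
`Σᵢ (λᵢ/2)·((1+xᵢ)·log₂(1+xᵢ) + (1−xᵢ)·log₂(1−xᵢ)) ≤ (4/η²)·Σᵢ μᵢ²/λᵢ`. -/
theorem relative_entropy_bound
    (m : ℕ) (hm : 1 ≤ m) (lam mu : Fin m → ℝ)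
    (hlam : ∀ i, 0 < lam i) (hmu : ∀ i, 0 ≤ mu i)
    (η : ℝ) (hη : 0 < η) (h : ∀ i, 2 * mu i ≤ η * lam i) :
    ∑ i, (lam i / 2) *
        ((1 + 2 * mu i / (η * lam i)) * Real.logb 2 (1 + 2 * mu i / (η * lam i))
          + (1 - 2 * mu i / (η * lam i)) * Real.logb 2 (1 - 2 * mu i / (η * lam i)))
      ≤ (4 / η ^ 2) * ∑ i, (mu i) ^ 2 / lam i := by
  rw [Finset.mul_sum]
  refine Finset.sum_le_sum fun i _ => ?_
  have hl := hlam i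
  have hd : 0 < η * lam i := mul_pos hη hl
  have hx : 0 ≤ 2 * mu i / (η * lam i) := div_nonneg (by linarith [hmu i]) hd.le
  have hx1 : 2 * mu i / (η * lam i) ≤ 1 := (div_le_one hd).mpr (h i)
  refine (mul_le_mul_of_nonneg_left
    (one_add_mul_logb_two_add_one_sub_mul_logb_two_le hx hx1) (by positivity)).trans_eq ?_
  field_simp
  ring
end
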